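/- Let G be a strongly regular graph with parameters (1911, 270, 105, 27) containing an induced quadrangle x ~ u ~ y ~ v ~ x. Then there is no independent set S of order 5 inside the neighbourhood of x with u ∈ S and v ∈ S; that is, there is no 5-element set S of vertices, all adjacent to x and pairwise non-adjacent, containing both u and v. -/

import Mathlib

open Finset in
/-- A Bonferroni-type inequality: if `S` is an independent set inside `N`, counting the vertices
of `N` that lie in `S` or have a neighbour in `S` up to the second order gives at most `|N|`. -/
theorem SimpleGraph.three_mul_sum_add_two_mul_card_le {V : Type*} [DecidableEq V]
    (G : SimpleGraph V) [DecidableRel G.Adj] (N S : Finset V) (hS : S ⊆ N)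
    (hind : ∀ a ∈ S, ∀ b ∈ S, a ≠ b → ¬ G.Adj a b) :
    3 * ∑ a ∈ S, #{z ∈ N | G.Adj a z} + 2 * #S ≤
      ∑ a ∈ S, ∑ b ∈ S, #{z ∈ N | G.Adj a z ∧ G.Adj b z} + 2 * #N := by
  have h₁ : ∑ a ∈ S, #{z ∈ N | G.Adj a z} = ∑ z ∈ N, #{a ∈ S | G.Adj a z} :=
    sum_card_bipartiteAbove_eq_sum_card_bipartiteBelow G.Adj
  have h₂ : ∑ a ∈ S, ∑ b ∈ S, #{z ∈ N | G.Adj a z ∧ G.Adj b z} =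
      ∑ z ∈ N, #{a ∈ S | G.Adj a z} * #{a ∈ S | G.Adj a z} := by
    rw [← sum_product' S S fun a b => #{z ∈ N | G.Adj a z ∧ G.Adj b z}]
    refine (sum_card_bipartiteAbove_eq_sum_card_bipartiteBelow
      fun (p : V × V) z => G.Adj p.1 z ∧ G.Adj p.2 z).trans (sum_congr rfl fun z _ => ?_)
    rw [← card_product, ← filter_product]
    rfl
  have h₃ : #S = ∑ z ∈ N, if z ∈ S then 1 else 0 := by
    rw [← card_filter, filter_mem_eq_inter, inter_eq_right.2 hS]
  have h₄ : #N = ∑ z ∈ N, 1 := card_eq_sum_ones N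
  rw [h₁, h₂, h₃, h₄, mul_sum, mul_sum, mul_sum, ← sum_add_distrib, ← sum_add_distrib]
  refine sum_le_sum fun z _ => ?_
  split_ifs with hz
  · have : #{a ∈ S | G.Adj a z} = 0 := by
      rw [card_eq_zero, filter_eq_empty_iff]
      exact fun a ha haz => hind a ha z hz haz.ne haz
    simp [this]
  · generalize #{a ∈ S | G.Adj a z} = d
    rcases Nat.lt_or_ge d 3 with hd | hd
    · interval_cases d <;> simp
    · nlinarith

open Finset in

/-- Let `G` be a strongly regular graph with parameters `(1911, 270, 105, 27)` containing an
induced quadrangle `x ~ u ~ y ~ v ~ x`. Then there is no independent set `S` of order `5`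
inside the neighbourhood of `x` containing both `u` and `v`. -/
theorem srg_1911_no_indep_five {V : Type*} [Fintype V] (G : SimpleGraph V)
    [DecidableRel G.Adj] (h : G.IsSRGWith 1911 270 105 27)
    (x u y v : V)
    (hd : x ≠ u ∧ x ≠ y ∧ x ≠ v ∧ u ≠ y ∧ u ≠ v ∧ y ≠ v)
    (hxu : G.Adj x u) (huy : G.Adj u y) (hyv : G.Adj y v) (hvx : G.Adj v x)
    (hxy : ¬ G.Adj x y) (huv : ¬ G.Adj u v) :
    ¬ ∃ S : Finset V, S.card = 5 ∧ u ∈ S ∧ v ∈ S ∧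
        (∀ w ∈ S, G.Adj x w) ∧ (∀ a ∈ S, ∀ b ∈ S, a ≠ b → ¬ G.Adj a b) := by
  classical
  rintro ⟨S, hcard, hu, hv, hx, hind⟩
  have hcn (a b : V) :
      Fintype.card (G.commonNeighbors a b) = #{z | G.Adj a z ∧ G.Adj b z} :=
    Fintype.card_of_subtype _ (by simp [SimpleGraph.mem_commonNeighbors])
  have hNcard : #(G.neighborFinset x) = 270 := h.regular x
  have hdeg (a : V) (ha : a ∈ S) : #{z ∈ G.neighborFinset x | G.Adj a z} = 105 := by
    rw [← h.of_adj x a (hx a ha), hcn]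
    congr 1
    ext z
    simp
  have hpair (a : V) (ha : a ∈ S) (b : V) (hb : b ∈ S) (hab : a ≠ b) :
      #{z ∈ G.neighborFinset x | G.Adj a z ∧ G.Adj b z} +
        (if a = u ∧ b = v ∨ a = v ∧ b = u then 1 else 0) ≤ 26 := by
    have h27 : #{z | G.Adj a z ∧ G.Adj b z} = 27 := by
      rw [← hcn]
      exact h.of_not_adj hab (hind a ha b hb hab)
    have hsub : {z ∈ G.neighborFinset x | G.Adj a z ∧ G.Adj b z} ⊆
        ({z | G.Adj a z ∧ G.Adj b z} : Finset V).erase x := by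
      intro z
      simp only [mem_filter, mem_erase, SimpleGraph.mem_neighborFinset, mem_univ, true_and]
      exact fun hz => ⟨hz.1.ne', hz.2⟩
    have hxmem : x ∈ ({z | G.Adj a z ∧ G.Adj b z} : Finset V) := by
      simp [(hx a ha).symm, (hx b hb).symm]
    have herase : #(({z | G.Adj a z ∧ G.Adj b z} : Finset V).erase x) = 26 := by
      rw [card_erase_of_mem hxmem, h27]
    split_ifs with huv'
    · have hlt := card_lt_card (ssubset_of_subset_of_ne hsub fun heq => by
        have hy : y ∈ ({z | G.Adj a z ∧ G.Adj b z} : Finset V).erase x := by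
          rcases huv' with ⟨rfl, rfl⟩ | ⟨rfl, rfl⟩ <;> simp [hd.2.1.symm, huy, hyv.symm]
        rw [← heq] at hy
        simp [hxy] at hy)
      omega
    · have := card_le_card hsub
      omega
  have hbound (a : V) (ha : a ∈ S) :
      ∑ b ∈ S, #{z ∈ G.neighborFinset x | G.Adj a z ∧ G.Adj b z} +
        (if a = u ∨ a = v then 1 else 0) ≤ 209 := by
    have hle : ∑ b ∈ S.erase a, (#{z ∈ G.neighborFinset x | G.Adj a z ∧ G.Adj b z} +
        (if a = u ∧ b = v ∨ a = v ∧ b = u then 1 else 0)) ≤ #(S.erase a) • 26 :=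
      sum_le_card_nsmul _ _ _ fun b hb =>
        hpair a ha b (mem_of_mem_erase hb) (ne_of_mem_erase hb).symm
    have hone : (if a = u ∨ a = v then 1 else 0) ≤
        ∑ b ∈ S.erase a, (if a = u ∧ b = v ∨ a = v ∧ b = u then 1 else 0) := by
      split_ifs with hauv
      · rcases hauv with rfl | rfl
        · exact (by simp : 1 ≤ if a = a ∧ v = v ∨ a = v ∧ v = a then 1 else 0).trans
            (single_le_sum (f := fun b => if a = a ∧ b = v ∨ a = v ∧ b = a then 1 else 0)
              (fun _ _ => Nat.zero_le _) (mem_erase.2 ⟨hd.2.2.2.2.1.symm, hv⟩))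
        · exact (by simp : 1 ≤ if a = u ∧ u = a ∨ a = a ∧ u = u then 1 else 0).trans
            (single_le_sum (f := fun b => if a = u ∧ b = a ∨ a = a ∧ b = u then 1 else 0)
              (fun _ _ => Nat.zero_le _) (mem_erase.2 ⟨hd.2.2.2.2.1, hu⟩))
      · exact Nat.zero_le _
    have hdiag := hdeg a ha
    rw [sum_add_distrib, card_erase_of_mem ha, hcard] at hle
    rw [← add_sum_erase S _ ha]
    simp only [and_self, smul_eq_mul] at hle ⊢
    omega
  have htotal := sum_le_card_nsmul S _ _ hbound
  have htwo : ∑ a ∈ S, (if a = u ∨ a = v then 1 else 0) = 2 := by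
    rw [← card_filter, ← card_pair hd.2.2.2.2.1]
    congr 1
    ext a
    simp only [mem_filter, mem_insert, mem_singleton]
    exact ⟨fun ha => ha.2, fun ha => ⟨by rcases ha with rfl | rfl <;> assumption, ha⟩⟩
  have hbonf := G.three_mul_sum_add_two_mul_card_le (G.neighborFinset x) S
    (fun a ha => by simpa using hx a ha) hind
  rw [sum_add_distrib, htwo, hcard, smul_eq_mul] at htotal
  rw [sum_congr rfl hdeg, sum_const, hcard, hNcard, smul_eq_mul] at hbonf
  omega
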